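/- Let H > 0, ε > 0, and for each i = 1,…,n let D_i and D̂_i be probability distributions supported on [0,H] with Lévy distance ‖D_i − D̂_i‖_L ≤ ε. Then |OPT(D) − OPT(D̂)| ≤ (6nH + 3nε + 2)·ε, where D = ×_{i=1}^n D_i and D̂ = ×_{i=1}^n D̂_i. -/

import Mathlib

open MeasureTheory Set

namespace SingleItem

/-- A single-item mechanism for `n` bidders: (expected) allocation probabilities and
(expected) payments on each bid profile. -/
structure Mech (n : ℕ) where
  alloc : (Fin n → ℝ) → Fin n → ℝ
  pay : (Fin n → ℝ) → Fin n → ℝ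
  alloc_nonneg : ∀ b i, 0 ≤ alloc b i
  alloc_sum_le_one : ∀ b, ∑ i, alloc b i ≤ 1
  meas_alloc : ∀ i, Measurable fun b => alloc b i
  meas_pay : ∀ i, Measurable fun b => pay b i

/-- Utility of bidder `i` with value `vi` when the bid profile is `b`. -/
def util {n : ℕ} (M : Mech n) (i : Fin n) (vi : ℝ) (b : Fin n → ℝ) : ℝ :=
  vi * M.alloc b i - M.pay b i

/-- Dominant-strategy incentive compatibility. -/
def DSIC {n : ℕ} (M : Mech n) : Prop :=
  ∀ (i : Fin n) (v : Fin n → ℝ) (v' : ℝ),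
    util M i (v i) (Function.update v i v') ≤ util M i (v i) v

/-- (Ex-post) individual rationality. -/
def IR {n : ℕ} (M : Mech n) : Prop :=
  ∀ (i : Fin n) (v : Fin n → ℝ), 0 ≤ util M i (v i) v

/-- Expected revenue of a mechanism under (truthful) bids drawn from `D`. -/
noncomputable def Rev {n : ℕ} (M : Mech n) (D : Measure (Fin n → ℝ)) : ℝ :=
  ∫ b, (∑ i, M.pay b i) ∂D

/-- Optimal revenue over DSIC and IR mechanisms. -/
noncomputable def OPT {n : ℕ} (D : Measure (Fin n → ℝ)) : ℝ :=
  sSup {r | ∃ M : Mech n, DSIC M ∧ IR M ∧ r = Rev M D}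

/-- The Lévy distance between `P` and `Q` is at most `ε`. -/
def LevyLe (P Q : Measure ℝ) (ε : ℝ) : Prop :=
  ∀ x : ℝ, (P (Iic (x - ε))).toReal - ε ≤ (Q (Iic x)).toReal ∧
    (Q (Iic x)).toReal ≤ (P (Iic (x + ε))).toReal + ε

/-- The Kolmogorov distance between `P` and `Q` is at most `ε`. -/
def KolmogorovLe (P Q : Measure ℝ) (ε : ℝ) : Prop :=
  ∀ x : ℝ, |(P (Iic x)).toReal - (Q (Iic x)).toReal| ≤ ε

end SingleItem

namespace SingleItem

lemma mono_sub_mul_le {f : ℝ → ℝ} (hf : Monotone f) (a b : ℝ) :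
    (b - a) * f a ≤ ∫ t in a..b, f t := by
  rcases le_total a b with h | h
  · have := intervalIntegral.integral_mono_on (f := fun _ => f a) (g := f) (μ := volume) h
      intervalIntegrable_const
      hf.intervalIntegrable (fun x hx => hf hx.1)
    simpa using this
  · have := intervalIntegral.integral_mono_on (g := fun _ => f a) (f := f) (μ := volume) h
      hf.intervalIntegrable intervalIntegrable_const (fun x hx => hf hx.2)
    rw [intervalIntegral.integral_symm]
    simp only [intervalIntegral.integral_const, smul_eq_mul] at this
    linarith

lemma integral_subgrad_le {a u : ℝ → ℝ} (h : ∀ s s', (s - s') * a s' ≤ u s - u s') {w : ℝ}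
    (hw : 0 ≤ w) : ∫ t in (0:ℝ)..w, a t ≤ u w - u 0 := by
  have hconv : ConvexOn ℝ univ u := by
    refine ⟨convex_univ, fun x _ y _ α β hα hβ hab => ?_⟩
    simp only [smul_eq_mul]
    have h1 := mul_le_mul_of_nonneg_left (h x (α * x + β * y)) hα
    have h2 := mul_le_mul_of_nonneg_left (h y (α * x + β * y)) hβ
    obtain rfl : β = 1 - α := by linarith
    nlinarith
  have hmono : Monotone a := by
    intro s t hst
    rcases hst.eq_or_lt with rfl | hlt
    · exact le_rfl
    have h1 := h s t
    have h2 := h t s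
    have : 0 ≤ (t - s) * (a t - a s) := by nlinarith
    by_contra hc
    push Not at hc
    nlinarith [mul_pos (sub_pos.2 hlt) (sub_pos.2 hc)]
  refine intervalIntegral.integral_le_sub_of_hasDeriv_right_of_le (g' := fun x => derivWithin u (Ioi x) x)
    hw ?_ ?_ ?_ ?_
  · exact (hconv.continuousOn isOpen_univ).mono (subset_univ _)
  · intro x _
    exact hconv.hasDerivWithinAt_rightDeriv_of_mem_interior (by simp)
  · exact (hmono.locallyIntegrable).integrableOn_isCompact isCompact_Icc
  · intro x _
    have hd := hconv.hasDerivWithinAt_rightDeriv_of_mem_interior (x := x) (by simp)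
    have := hasDerivWithinAt_iff_tendsto_slope' (by simp : x ∉ Ioi x) |>.1 hd
    refine ge_of_tendsto this ?_
    filter_upwards [self_mem_nhdsWithin] with y hy
    have hy' : x < y := hy
    rw [slope_def_field, le_div_iff₀ (sub_pos.2 hy')]
    nlinarith [h y x]

/-- The key estimate for one bidder. -/
lemma key_one {a w : ℝ → ℝ} (ha : Monotone a) (ha0 : ∀ t, 0 ≤ a t) (hw : Monotone w)
    {ε : ℝ} (hε : 0 ≤ ε) (hw0 : ∀ t, 0 ≤ w t) (hle : ∀ t, 0 ≤ t → w t ≤ t + ε) {v : ℝ} (hv : 0 ≤ v) :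
    ∫ t in (0:ℝ)..v, a (w t) ≤ (∫ t in (0:ℝ)..(w v), a t) + (v + ε - w v) * a (w v) := by
  have hm : Monotone (fun s => a (min s (w v))) := fun s t hst => ha (min_le_min_right _ hst)
  have hm' : Monotone (fun s => a (min (s + ε) (w v))) :=
    fun s t hst => ha (min_le_min_right _ (by linarith))
  calc ∫ t in (0:ℝ)..v, a (w t) ≤ ∫ t in (0:ℝ)..v, a (min (t + ε) (w v)) := by
        refine intervalIntegral.integral_mono_on hv (ha.comp hw).intervalIntegrable
          hm'.intervalIntegrable fun t ht => ha (le_min (hle t ht.1) (hw ht.2))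
    _ = ∫ s in ε..(v + ε), a (min s (w v)) := by
        rw [intervalIntegral.integral_comp_add_right (fun s => a (min s (w v))) ε, zero_add]
    _ ≤ ∫ s in (0:ℝ)..(v + ε), a (min s (w v)) := by
        rw [← intervalIntegral.integral_add_adjacent_intervals (a := 0) (b := ε)
          (c := v + ε)
          hm.intervalIntegrable hm.intervalIntegrable]
        have : 0 ≤ ∫ s in (0:ℝ)..ε, a (min s (w v)) :=
          intervalIntegral.integral_nonneg hε fun _ _ => ha0 _
        linarith
    _ = (∫ s in (0:ℝ)..(w v), a (min s (w v))) + ∫ s in (w v)..(v + ε), a (min s (w v)) := by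
        rw [intervalIntegral.integral_add_adjacent_intervals
          hm.intervalIntegrable hm.intervalIntegrable]
    _ = _ := by
        congr 1
        · refine intervalIntegral.integral_congr fun s hs => ?_
          rw [uIcc_of_le (hw0 v)] at hs
          simp [min_eq_left hs.2]
        · have : ∫ s in (w v)..(v + ε), a (min s (w v)) = ∫ s in (w v)..(v + ε), a (w v) := by
            refine intervalIntegral.integral_congr fun s hs => ?_
            rw [uIcc_of_le (hle v hv)] at hs
            simp [min_eq_right hs.1]
          rw [this]; simp

lemma map_update_eq {n : ℕ} (w : Fin n → ℝ → ℝ) (b : Fin n → ℝ) (i : Fin n) (t : ℝ) :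
    (fun j => w j (Function.update b i t j)) =
      Function.update (fun j => w j (b j)) i (w i t) := by
  funext j
  by_cases h : j = i
  · subst h; simp
  · simp [h]

lemma DSIC.subgrad {n : ℕ} {M : Mech n} (hM : DSIC M) (W : Fin n → ℝ) (i : Fin n) (s s' : ℝ) :
    (s - s') * M.alloc (Function.update W i s') i ≤
      util M i s (Function.update W i s) - util M i s' (Function.update W i s') := by
  have := hM i (Function.update W i s) s'
  simp only [Function.update_self, Function.update_idem] at this
  unfold util at *
  linarith

lemma DSIC.mono {n : ℕ} {M : Mech n} (hM : DSIC M) (W : Fin n → ℝ) (i : Fin n) :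
    Monotone fun s => M.alloc (Function.update W i s) i := by
  intro s t hst
  rcases hst.eq_or_lt with rfl | hlt
  · exact le_rfl
  have h1 := hM.subgrad W i s t
  have h2 := hM.subgrad W i t s
  by_contra hc
  push Not at hc
  nlinarith [mul_pos (sub_pos.2 hlt) (sub_pos.2 hc)]

/-- allocation of the transformed mechanism -/
noncomputable def tAlloc {n : ℕ} (M : Mech n) (w : Fin n → ℝ → ℝ) (b : Fin n → ℝ) (i : Fin n) : ℝ :=
  if 0 ≤ b i then M.alloc (fun j => w j (b j)) i else 0

/-- utility of the transformed mechanism -/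
noncomputable def tUtil {n : ℕ} (M : Mech n) (w : Fin n → ℝ → ℝ) (b : Fin n → ℝ) (i : Fin n) : ℝ :=
  ∫ t, if 0 < t ∧ t ≤ b i then tAlloc M w (Function.update b i t) i else 0

lemma tAlloc_nonneg {n : ℕ} (M : Mech n) (w : Fin n → ℝ → ℝ) (b : Fin n → ℝ) (i : Fin n) :
    0 ≤ tAlloc M w b i := by
  unfold tAlloc; split_ifs
  · exact M.alloc_nonneg _ _
  · exact le_rfl

lemma tAlloc_mono {n : ℕ} {M : Mech n} (hM : DSIC M) {w : Fin n → ℝ → ℝ}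
    (hw : ∀ i, Monotone (w i)) (b : Fin n → ℝ) (i : Fin n) :
    Monotone fun t => tAlloc M w (Function.update b i t) i := by
  intro s t hst
  by_cases hs : 0 ≤ s
  · have ht := hs.trans hst
    simp only [tAlloc, Function.update_self, hs, ht, if_true, map_update_eq]
    exact hM.mono _ i (hw i hst)
  · have : tAlloc M w (Function.update b i s) i = 0 := by simp [tAlloc, hs]
    simp only [this]
    exact tAlloc_nonneg _ _ _ _

lemma tUtil_eq {n : ℕ} (M : Mech n) (w : Fin n → ℝ → ℝ) (b : Fin n → ℝ) (i : Fin n) :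
    tUtil M w b i = ∫ t in (0:ℝ)..(b i), tAlloc M w (Function.update b i t) i := by
  have h1 : tUtil M w b i = ∫ t in Ioc 0 (b i), tAlloc M w (Function.update b i t) i := by
    rw [← integral_indicator measurableSet_Ioc]
    unfold tUtil
    refine integral_congr_ae (Filter.Eventually.of_forall fun t => ?_)
    simp only [indicator, mem_Ioc]
  rcases le_or_gt 0 (b i) with h | h
  · rw [h1, intervalIntegral.integral_of_le h]
  · rw [h1, Ioc_eq_empty (by simpa using h.le), intervalIntegral.integral_of_ge h.le,
      integral_Ioc_eq_integral_Ioo]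
    rw [setIntegral_congr_fun (g := fun _ => 0) measurableSet_Ioo]
    · simp
    · intro t ht
      simp [tAlloc, ht.2]

lemma meas_tAlloc {n : ℕ} (M : Mech n) {w : Fin n → ℝ → ℝ}
    (hw : ∀ i, Measurable (w i)) (i : Fin n) : Measurable fun b => tAlloc M w b i := by
  unfold tAlloc
  refine Measurable.ite (measurableSet_le measurable_const (measurable_pi_apply i)) ?_
    measurable_const
  exact (M.meas_alloc i).comp (measurable_pi_lambda _ fun j => (hw j).comp (measurable_pi_apply j))

lemma meas_tUtil {n : ℕ} (M : Mech n) {w : Fin n → ℝ → ℝ}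
    (hw : ∀ i, Measurable (w i)) (i : Fin n) : Measurable fun b => tUtil M w b i := by
  have hupd : Measurable fun z : (Fin n → ℝ) × ℝ => Function.update z.1 i z.2 := by
    refine measurable_pi_lambda _ fun j => ?_
    by_cases h : j = i
    · subst h; simpa using measurable_snd
    · simp only [Function.update_of_ne h]
      exact (measurable_pi_apply j).comp measurable_fst
  have : Measurable fun z : (Fin n → ℝ) × ℝ =>
      if 0 < z.2 ∧ z.2 ≤ z.1 i then tAlloc M w (Function.update z.1 i z.2) i else 0 := by
    refine Measurable.ite ?_ ((meas_tAlloc M hw i).comp hupd) measurable_const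
    exact (measurableSet_lt measurable_const measurable_snd).inter
      (measurableSet_le measurable_snd ((measurable_pi_apply i).comp measurable_fst))
  exact this.stronglyMeasurable.integral_prod_right.measurable

/-- The transformed mechanism. -/
noncomputable def tMech {n : ℕ} (M : Mech n) (w : Fin n → ℝ → ℝ)
    (hw : ∀ i, Measurable (w i)) : Mech n where
  alloc := tAlloc M w
  pay b i := b i * tAlloc M w b i - tUtil M w b i
  alloc_nonneg := tAlloc_nonneg M w
  alloc_sum_le_one b := by
    refine le_trans (Finset.sum_le_sum fun i _ => ?_) (M.alloc_sum_le_one fun j => w j (b j))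
    unfold tAlloc; split_ifs
    · exact le_rfl
    · exact M.alloc_nonneg _ _
  meas_alloc := meas_tAlloc M hw
  meas_pay i := ((measurable_pi_apply i).mul (meas_tAlloc M hw i)).sub (meas_tUtil M hw i)

lemma transform {n : ℕ} {M : Mech n} (hM : DSIC M) (hIR : IR M) {w : Fin n → ℝ → ℝ}
    (hw : ∀ i, Monotone (w i)) {ε : ℝ} (hε : 0 ≤ ε) (hw0 : ∀ i t, 0 ≤ w i t)
    (hle : ∀ i t, 0 ≤ t → w i t ≤ t + ε) :
    ∃ M' : Mech n, DSIC M' ∧ IR M' ∧ (∀ b : Fin n → ℝ, 0 ≤ ∑ i, M'.pay b i) ∧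
      ∀ b : Fin n → ℝ, (∀ i, 0 ≤ b i) →
        (∑ i, M.pay (fun j => w j (b j)) i) - ε ≤ ∑ i, M'.pay b i := by
  have hself : ∀ (b : Fin n → ℝ) i, tAlloc M w (Function.update b i (b i)) i = tAlloc M w b i := by
    intro b i; rw [Function.update_eq_self]
  refine ⟨tMech M w fun i => (hw i).measurable, ?_, ?_, ?_, ?_⟩
  · intro i v v'
    simp only [util, tMech, tUtil_eq, Function.update_self, Function.update_idem]
    have h1 := mono_sub_mul_le (tAlloc_mono hM hw v i) v' (v i)
    have h2 := intervalIntegral.integral_add_adjacent_intervals (a := 0) (b := v') (c := v i)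
      (μ := volume) (tAlloc_mono hM hw v i).intervalIntegrable
      (tAlloc_mono hM hw v i).intervalIntegrable
    linarith
  · intro i v
    simp only [util, tMech, sub_sub_cancel]
    refine integral_nonneg fun t => ?_
    simp only [Pi.zero_apply]
    split_ifs
    · exact tAlloc_nonneg _ _ _ _
    · exact le_rfl
  · intro b
    refine Finset.sum_nonneg fun i _ => ?_
    simp only [tMech, tUtil_eq]
    have h1 := mono_sub_mul_le (tAlloc_mono hM hw b i) (b i) 0
    rw [intervalIntegral.integral_symm] at h1
    simp only [hself] at h1
    linarith
  · intro b hb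
    have hsum := M.alloc_sum_le_one (fun j => w j (b j))
    have : ∀ i, M.pay (fun j => w j (b j)) i - ε * M.alloc (fun j => w j (b j)) i ≤
        (tMech M w fun i => (hw i).measurable).pay b i := by
      intro i
      set W := fun j => w j (b j) with hW
      have hk := key_one (hM.mono W i) (fun t => M.alloc_nonneg _ _) (hw i) hε (hw0 i) (hle i) (hb i)
      have hu := integral_subgrad_le (u := fun s => util M i s (Function.update W i s))
        (hM.subgrad W i) (hw0 i (b i))
      have h0 := hIR i (Function.update W i 0)
      have hWi : Function.update W i (w i (b i)) = W := by
        have : W i = w i (b i) := rfl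
        rw [← this, Function.update_eq_self]
      simp only [Function.update_self] at h0
      simp only [hWi] at hk hu
      have hUt : tUtil M w b i = ∫ t in (0:ℝ)..(b i), M.alloc (Function.update W i (w i t)) i := by
        rw [tUtil_eq]
        refine intervalIntegral.integral_congr fun t ht => ?_
        rw [uIcc_of_le (hb i)] at ht
        simp [tAlloc, ht.1, map_update_eq, hW]
      have hA : tAlloc M w b i = M.alloc W i := by simp [tAlloc, hb i, hW]
      simp only [tMech, hUt, hA]
      unfold util at *
      nlinarith
    have h2 := Finset.sum_le_sum fun i (_ : i ∈ Finset.univ) => this i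
    rw [Finset.sum_sub_distrib, ← Finset.mul_sum] at h2
    nlinarith

end SingleItem

namespace SingleItem
open ProbabilityTheory

/-- Quantile function of a distribution on `[0,∞)`. -/
noncomputable def qf (P : Measure ℝ) (q : ℝ) : ℝ := sInf {x | 0 ≤ x ∧ min q 1 ≤ cdf P x}

/-- Distributional transform. -/
noncomputable def dtr (P : Measure ℝ) (t r : ℝ) : ℝ :=
  P.real (Iio t) + r * (cdf P t - P.real (Iio t))

/-- uniform distribution -/
noncomputable def unif : Measure ℝ := volume.restrict (Ioc 0 1)

instance : IsProbabilityMeasure unif := ⟨by simp [unif]⟩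

lemma qf_bdd {P : Measure ℝ} (q : ℝ) : BddBelow {x | 0 ≤ x ∧ min q 1 ≤ cdf P x} := ⟨0, fun _ h => h.1⟩

lemma qf_nonneg {P : Measure ℝ} (q : ℝ) : 0 ≤ qf P q := Real.sInf_nonneg fun _ h => h.1

section
variable {P : Measure ℝ} [IsProbabilityMeasure P] {H : ℝ}

lemma cdf_H (hP : P (Icc 0 H) = 1) : cdf P H = 1 := by
  rw [cdf_eq_real, measureReal_def]
  have : P (Iic H) = 1 := le_antisymm prob_le_one (hP ▸ measure_mono Icc_subset_Iic_self)
  simp [this]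

lemma P_neg (hP : P (Icc 0 H) = 1) {x : ℝ} (hx : x < 0) : P (Iic x) = 0 := by
  have h : P (Icc 0 H)ᶜ = 0 := (prob_compl_eq_zero_iff measurableSet_Icc).2 hP
  have hsub : Iic x ⊆ (Icc 0 H)ᶜ := by
    intro y hy hy'
    exact absurd (hy'.1.trans hy) (not_le.2 hx)
  exact measure_mono_null hsub h

lemma qf_mem (hH : 0 ≤ H) (hP : P (Icc 0 H) = 1) (q : ℝ) :
    H ∈ {x | 0 ≤ x ∧ min q 1 ≤ cdf P x} := ⟨hH, by rw [cdf_H hP]; exact min_le_right _ _⟩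

lemma qf_le_H (hH : 0 ≤ H) (hP : P (Icc 0 H) = 1) (q : ℝ) : qf P q ≤ H :=
  csInf_le (qf_bdd q) (qf_mem hH hP q)

lemma qf_mono (hH : 0 ≤ H) (hP : P (Icc 0 H) = 1) : Monotone (qf P) := fun q q' h =>
  csInf_le_csInf (qf_bdd q) ⟨H, qf_mem hH hP q'⟩
    fun _ hx => ⟨hx.1, (min_le_min_right _ h).trans hx.2⟩

lemma qf_le_iff (hH : 0 ≤ H) (hP : P (Icc 0 H) = 1) {q x : ℝ} (hx : 0 ≤ x) :
    qf P q ≤ x ↔ min q 1 ≤ cdf P x := by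
  constructor
  · intro h
    have hr : Filter.Tendsto (cdf P) (nhdsWithin x (Ioi x)) (nhds (cdf P x)) :=
      ((cdf P).right_continuous x).tendsto.mono_left (nhdsWithin_mono _ Ioi_subset_Ici_self)
    refine ge_of_tendsto hr ?_
    filter_upwards [self_mem_nhdsWithin] with y hy
    obtain ⟨z, hz, hzy⟩ := exists_lt_of_csInf_lt ⟨H, qf_mem hH hP q⟩ (lt_of_le_of_lt h hy)
    exact hz.2.trans (monotone_cdf P hzy.le)
  · intro h
    exact csInf_le (qf_bdd q) ⟨hx, h⟩

lemma map_qf (hH : 0 ≤ H) (hP : P (Icc 0 H) = 1) : unif.map (qf P) = P := by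
  have hm := (qf_mono hH hP).measurable
  have : IsProbabilityMeasure (unif.map (qf P)) := Measure.isProbabilityMeasure_map hm.aemeasurable
  refine Measure.ext_of_Iic _ _ fun a => ?_
  rw [Measure.map_apply hm measurableSet_Iic, unif, Measure.restrict_apply (hm measurableSet_Iic)]
  rcases lt_or_ge a 0 with ha | ha
  · rw [P_neg hP ha]
    convert measure_empty (μ := volume)
    ext q
    simp only [mem_inter_iff, mem_preimage, mem_Iic, mem_empty_iff_false, iff_false]
    intro h
    linarith [qf_nonneg (P := P) q, h.1]
  · have : qf P ⁻¹' Iic a ∩ Ioc 0 1 = Ioc 0 (cdf P a) := by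
      ext q
      simp only [mem_inter_iff, mem_preimage, mem_Iic, mem_Ioc, qf_le_iff hH hP ha]
      have := cdf_le_one P a
      constructor
      · rintro ⟨h1, h2, h3⟩
        rw [min_eq_left h3] at h1
        exact ⟨h2, h1⟩
      · rintro ⟨h1, h2⟩
        exact ⟨(min_le_left _ _).trans h2, h1, h2.trans this⟩
    rw [this, Real.volume_Ioc, sub_zero, ofReal_cdf]

lemma real_Iio_le (t : ℝ) : P.real (Iio t) ≤ cdf P t := by
  rw [cdf_eq_real]; exact measureReal_mono Iio_subset_Iic_self

lemma cdf_le_real_Iio {s t : ℝ} (h : s < t) : cdf P s ≤ P.real (Iio t) := by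
  rw [cdf_eq_real]; exact measureReal_mono (Iic_subset_Iio.2 h)

lemma dtr_le {r : ℝ} (hr : r ∈ Ioc (0:ℝ) 1) (t : ℝ) : dtr P t r ≤ cdf P t := by
  unfold dtr; nlinarith [real_Iio_le (P := P) t, hr.2]

lemma le_dtr {r : ℝ} (hr : r ∈ Ioc (0:ℝ) 1) (t : ℝ) : P.real (Iio t) ≤ dtr P t r := by
  unfold dtr; nlinarith [real_Iio_le (P := P) t, hr.1]

lemma dtr_mono {r : ℝ} (hr : r ∈ Ioc (0:ℝ) 1) : Monotone fun t => dtr P t r := by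
  intro s t hst
  rcases hst.eq_or_lt with rfl | h
  · exact le_rfl
  · exact (dtr_le hr s).trans ((cdf_le_real_Iio h).trans (le_dtr hr t))

lemma meas_dtr : Measurable fun z : ℝ × ℝ => dtr P z.1 z.2 := by
  have h1 : Measurable fun t => P.real (Iio t) :=
    Monotone.measurable fun s t h => measureReal_mono (Iio_subset_Iio h)
  have h2 : Measurable (cdf P) := (monotone_cdf P).measurable
  unfold dtr
  exact (h1.comp measurable_fst).add
    (measurable_snd.mul ((h2.comp measurable_fst).sub (h1.comp measurable_fst)))

lemma real_Iio_le_of {a t : ℝ} (h : ∀ s < t, cdf P s ≤ a) : P.real (Iio t) ≤ a := by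
  obtain ⟨u, hu, hlt, hlim⟩ := exists_seq_strictMono_tendsto t
  have hU : Iio t = ⋃ k, Iic (u k) := by
    ext x
    simp only [mem_Iio, mem_iUnion, mem_Iic]
    constructor
    · intro hx
      exact ((hlim.eventually (lt_mem_nhds hx)).exists).imp fun k hk => hk.le
    · rintro ⟨k, hk⟩
      exact hk.trans_lt (hlt k)
  have hmono : Monotone fun k => Iic (u k) := fun i j hij => Iic_subset_Iic.2 (hu.monotone hij)
  have := tendsto_measure_iUnion_atTop (μ := P) hmono
  rw [← hU] at this
  have h2 := (ENNReal.tendsto_toReal (measure_ne_top P (Iio t))).comp this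
  refine le_of_tendsto h2 (Filter.Eventually.of_forall fun k => ?_)
  have := h (u k) (hlt k)
  rwa [cdf_eq_real] at this

lemma real_singleton (t : ℝ) : P.real {t} = cdf P t - P.real (Iio t) := by
  have : Iic t = Iio t ∪ {t} := by ext x; simp [le_iff_lt_or_eq]
  rw [cdf_eq_real, this, measureReal_union (by simp) (measurableSet_singleton t)]
  ring

lemma map_dtr (hP : P (Icc 0 H) = 1) :
    (P.prod unif).map (fun z => dtr P z.1 z.2) = unif := by
  have hm := meas_dtr (P := P)
  have : IsProbabilityMeasure ((P.prod unif).map (fun z => dtr P z.1 z.2)) :=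
    Measure.isProbabilityMeasure_map hm.aemeasurable
  have hU : ∀ᵐ z ∂(P.prod unif), z.2 ∈ Ioc (0:ℝ) 1 := by
    have : ∀ᵐ r ∂unif, r ∈ Ioc (0:ℝ) 1 := ae_restrict_mem measurableSet_Ioc
    exact Measure.quasiMeasurePreserving_snd.ae this
  have hunif : ∀ a ∈ Icc (0:ℝ) 1, unif (Iic a) = ENNReal.ofReal a := by
    intro a ha
    rw [unif, Measure.restrict_apply measurableSet_Iic, inter_comm, Ioc_inter_Iic,
      min_eq_right ha.2, Real.volume_Ioc, sub_zero]
  refine Measure.ext_of_Iic _ _ fun a => ?_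
  rw [Measure.map_apply hm measurableSet_Iic]
  rcases lt_or_ge a 0 with ha | ha
  · have h1 : unif (Iic a) = 0 := by
      rw [unif, Measure.restrict_apply measurableSet_Iic, inter_comm, Ioc_inter_Iic,
        Ioc_eq_empty (by simp [ha.le])]
      simp
    rw [h1, measure_eq_zero_iff_ae_notMem]
    filter_upwards [hU] with z hz hz'
    have := le_dtr (P := P) hz z.1
    have h0 : 0 ≤ P.real (Iio z.1) := measureReal_nonneg
    have : dtr P z.1 z.2 ≤ a := hz'
    linarith
  rcases le_or_gt 1 a with ha1 | ha1
  · have h1 : unif (Iic a) = 1 := by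
      rw [unif, Measure.restrict_apply measurableSet_Iic, inter_comm, Ioc_inter_Iic,
        min_eq_left ha1]
      simp
    rw [h1]
    refine (mem_ae_iff_prob_eq_one (hm measurableSet_Iic)).1 ?_
    filter_upwards [hU] with z hz
    exact (dtr_le (P := P) hz z.1).trans ((cdf_le_one P _).trans ha1)
  set S := {t | a < cdf P t} with hS
  have hSne : S.Nonempty := ⟨H, by simp [hS, cdf_H hP, ha1]⟩
  have hSb : BddBelow S := by
    refine ⟨0, fun t ht => ?_⟩
    by_contra hc
    push Not at hc
    have : cdf P t = 0 := by rw [cdf_eq_real, measureReal_def, P_neg hP hc]; simp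
    simp only [hS, mem_ofPred_eq, this] at ht
    linarith
  set t0 := sInf S with ht0
  have hlt : ∀ t < t0, cdf P t ≤ a := fun t ht => by
    by_contra hc
    push Not at hc
    exact absurd (csInf_le hSb hc) (not_le.2 ht)
  have hgt : ∀ t, t0 < t → a < P.real (Iio t) := fun t ht => by
    obtain ⟨z, hz, hzy⟩ := exists_lt_of_csInf_lt hSne ht
    exact lt_of_lt_of_le hz (cdf_le_real_Iio hzy)
  have hle0 : P.real (Iio t0) ≤ a := real_Iio_le_of hlt
  have hge0 : a ≤ cdf P t0 := by
    have hr : Filter.Tendsto (cdf P) (nhdsWithin t0 (Ioi t0)) (nhds (cdf P t0)) :=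
      ((cdf P).right_continuous t0).tendsto.mono_left (nhdsWithin_mono _ Ioi_subset_Ici_self)
    refine ge_of_tendsto hr ?_
    filter_upwards [self_mem_nhdsWithin] with y hy
    exact (hgt y hy).le.trans (real_Iio_le y)
  set m := cdf P t0 - P.real (Iio t0) with hmdef
  set R := {r : ℝ | r * m ≤ a - P.real (Iio t0)} with hR
  have hRm : MeasurableSet R := measurableSet_le (by fun_prop) measurable_const
  have hset : (fun z : ℝ × ℝ => dtr P z.1 z.2) ⁻¹' Iic a =ᵐ[P.prod unif]
      ((Iio t0 ×ˢ univ) ∪ ({t0} ×ˢ R) : Set (ℝ × ℝ)) := by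
    filter_upwards [hU] with z hz
    refine propext ?_
    change dtr P z.1 z.2 ≤ a ↔ z ∈ ((Iio t0 ×ˢ univ) ∪ ({t0} ×ˢ R) : Set (ℝ × ℝ))
    simp only [mem_union, mem_prod, mem_Iio, mem_univ, and_true, mem_singleton_iff]
    rcases lt_trichotomy z.1 t0 with h | h | h
    · simp only [h, true_or, iff_true]
      exact (dtr_le hz _).trans (hlt _ h)
    · simp only [h, lt_irrefl, false_or, true_and, hR, mem_ofPred_eq, dtr, ← hmdef]
      constructor <;> intro h <;> linarith
    · simp only [h.not_gt, h.ne', false_and, or_false, iff_false, not_le]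
      exact (hgt _ h).trans_le (le_dtr hz _)
  rw [measure_congr hset, measure_union _ ((measurableSet_singleton t0).prod hRm),
    Measure.prod_prod, Measure.prod_prod, measure_univ, mul_one, hunif a ⟨ha, ha1.le⟩]
  swap
  · rw [Set.disjoint_left]
    rintro z hz hz'
    simp only [mem_prod, mem_Iio, mem_singleton_iff] at hz hz'
    exact absurd hz.1 (by simp [hz'.1])
  rw [← ofReal_measureReal (μ := P) (s := Iio t0), ← ofReal_measureReal (μ := P) (s := {t0}),
    real_singleton, ← hmdef]
  have hm0 : 0 ≤ m := sub_nonneg.2 (real_Iio_le _)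
  rcases hm0.eq_or_lt with h | h
  · rw [← h]
    simp only [ENNReal.ofReal_zero, zero_mul, add_zero]
    congr 1
    linarith
  · have hRe : R = Iic ((a - P.real (Iio t0)) / m) := by
      ext r
      simp only [hR, mem_ofPred_eq, mem_Iic, le_div_iff₀ h]
    have h1 : 0 ≤ (a - P.real (Iio t0)) / m := div_nonneg (by linarith) h.le
    rw [hRe, hunif _ ⟨h1, by rw [div_le_one h]; linarith⟩,
      ← ENNReal.ofReal_mul h.le, mul_div_cancel₀ _ h.ne', ← ENNReal.ofReal_add measureReal_nonneg (by linarith)]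
    congr 1
    ring
end

end SingleItem

namespace SingleItem
open ProbabilityTheory

lemma shift_bound {n : ℕ} {h : (Fin n → ℝ) → ℝ} (hm : Measurable h) {H ε : ℝ} (hε : 0 ≤ ε)
    (h0 : ∀ q, 0 ≤ h q) (hH : ∀ q, h q ≤ H) :
    (∫ q, h q ∂(Measure.pi fun _ : Fin n => unif)) - n * H * ε ≤
      ∫ q, h (fun i => q i - ε) ∂(Measure.pi fun _ : Fin n => unif) := by
  have hHn : 0 ≤ H := (h0 0).trans (hH 0)
  have hpi : (Measure.pi fun _ : Fin n => unif) =
      (volume : Measure (Fin n → ℝ)).restrict (univ.pi fun _ => Ioc 0 1) := by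
    rw [volume_pi, Measure.restrict_pi_pi]; rfl
  have hprob : IsProbabilityMeasure (Measure.pi fun _ : Fin n => unif) := inferInstance
  set B : Set (Fin n → ℝ) := univ.pi fun _ => Ioc 0 1 with hB
  set B1 : Set (Fin n → ℝ) := univ.pi fun _ => Ioc ε 1 with hB1
  set B0 : Set (Fin n → ℝ) := univ.pi fun _ => Ioc 0 (1 - ε) with hB0
  have mB : MeasurableSet B := MeasurableSet.univ_pi fun _ => measurableSet_Ioc
  have mB0 : MeasurableSet B0 := MeasurableSet.univ_pi fun _ => measurableSet_Ioc
  have mB1 : MeasurableSet B1 := MeasurableSet.univ_pi fun _ => measurableSet_Ioc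
  have hB1B : B1 ⊆ B := Set.pi_mono fun _ _ => Ioc_subset_Ioc_left hε
  have hB0B : B0 ⊆ B := Set.pi_mono fun _ _ => Ioc_subset_Ioc_right (by linarith)
  have volB : (volume : Measure (Fin n → ℝ)) B = 1 := by
    simp [hB, volume_pi, Measure.pi_pi]
  have msh : Measurable fun q : Fin n → ℝ => fun i => q i - ε :=
    measurable_pi_lambda _ fun i => (measurable_pi_apply i).sub_const _
  have hbint : ∀ f : (Fin n → ℝ) → ℝ, Measurable f → (∀ q, 0 ≤ f q) → (∀ q, f q ≤ H) →
      IntegrableOn f B := by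
    intro f hf hf0 hfH
    refine Measure.integrableOn_of_bounded (M := H) (by simp [volB]) hf.aestronglyMeasurable
      (Filter.Eventually.of_forall fun q => ?_)
    rw [Real.norm_of_nonneg (hf0 q)]
    exact hfH q
  have i1 := hbint h hm h0 hH
  have i2 := hbint _ (hm.comp msh) (fun q => h0 _) (fun q => hH _)
  rw [hpi]
  have e1 : ∫ q in B1, h (fun i => q i - ε) ≤ ∫ q in B, h (fun i => q i - ε) :=
    setIntegral_mono_set i2 (Filter.Eventually.of_forall fun q => h0 _) hB1B.eventuallyLE
  have e2 : ∫ q in B1, h (fun i => q i - ε) = ∫ q in B0, h q := by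
    rw [← integral_indicator mB1, ← integral_indicator mB0,
      ← integral_sub_right_eq_self (B0.indicator h) (fun _ : Fin n => ε)]
    congr 1
    funext q
    have hiff : q ∈ B1 ↔ (q - fun _ => ε) ∈ B0 := by
      simp only [hB1, hB0, mem_univ_pi, mem_Ioc, Pi.sub_apply]
      refine forall_congr' fun i => ?_
      constructor <;> rintro ⟨_, _⟩ <;> constructor <;> linarith
    by_cases hq : q ∈ B1
    · rw [indicator_of_mem hq, indicator_of_mem (hiff.1 hq)]; rfl
    · rw [indicator_of_notMem hq, indicator_of_notMem (fun h => hq (hiff.2 h))]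
  have e3 : ∫ q in B, h q = (∫ q in B0, h q) + ∫ q in B \ B0, h q := by
    have := integral_inter_add_sdiff mB0 i1
    rw [inter_eq_self_of_subset_right hB0B] at this
    exact this.symm
  have e4 : ∫ q in B \ B0, h q ≤ H * (volume : Measure (Fin n → ℝ)).real (B \ B0) := by
    have hfin : (volume : Measure (Fin n → ℝ)) (B \ B0) ≠ ⊤ :=
      ne_top_of_le_ne_top (by simp [volB]) (measure_mono (sdiff_subset : B \ B0 ⊆ B))
    have := setIntegral_mono_on (μ := volume) (f := h) (g := fun _ => H) (i1.mono_set sdiff_subset)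
      (integrableOn_const hfin) (mB.diff mB0) (fun q _ => hH q)
    refine this.trans (le_of_eq ?_)
    simp [mul_comm]
  have e5 : (volume : Measure (Fin n → ℝ)).real (B \ B0) ≤ n * ε := by
    rw [measureReal_sdiff hB0B mB0 (by simp [volB])]
    have v0 : (volume : Measure (Fin n → ℝ)).real B0 = (max (1 - ε) 0) ^ n := by
      rw [measureReal_def, hB0, volume_pi, Measure.pi_pi]
      simp [ENNReal.toReal_ofReal']
    rw [v0, measureReal_def, volB, ENNReal.toReal_one]
    have hb := one_add_mul_le_pow (a := - min ε 1) (by linarith [min_le_right ε 1]) n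
    have : 1 + - min ε 1 = max (1 - ε) 0 := by
      rcases le_total ε 1 with h | h
      · rw [min_eq_left h, max_eq_left (by linarith)]; ring
      · rw [min_eq_right h, max_eq_right (by linarith)]; ring
    rw [this] at hb
    have hn : (n:ℝ) * min ε 1 ≤ n * ε := mul_le_mul_of_nonneg_left (min_le_left _ _) n.cast_nonneg
    linarith
  have e6 := mul_le_mul_of_nonneg_left e5 hHn
  nlinarith

lemma ae_supp {n : ℕ} {H : ℝ} {D : Fin n → Measure ℝ} [∀ i, IsProbabilityMeasure (D i)]
    (hD : ∀ i, D i (Icc 0 H) = 1) : ∀ᵐ b ∂(Measure.pi D), ∀ i, b i ∈ Icc 0 H := by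
  rw [ae_all_iff]
  intro i
  have : ∀ᵐ t ∂(D i), t ∈ Icc 0 H := (mem_ae_iff_prob_eq_one measurableSet_Icc).2 (hD i)
  exact Measure.tendsto_eval_ae_ae.eventually this

lemma sum_pay_le {n : ℕ} {M : Mech n} (hIR : IR M) {H : ℝ} (hH : 0 ≤ H) {v : Fin n → ℝ}
    (hv : ∀ i, v i ∈ Icc 0 H) : ∑ i, M.pay v i ≤ H := by
  have h1 : ∑ i, M.pay v i ≤ ∑ i, H * M.alloc v i := by
    refine Finset.sum_le_sum fun i _ => ?_
    have := hIR i v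
    unfold util at this
    nlinarith [mul_le_mul_of_nonneg_right (hv i).2 (M.alloc_nonneg v i)]
  rw [← Finset.mul_sum] at h1
  nlinarith [M.alloc_sum_le_one v]

lemma meas_sum_pay {n : ℕ} (M : Mech n) : Measurable fun v => ∑ i, M.pay v i :=
  Finset.measurable_fun_sum _ fun i _ => M.meas_pay i

lemma rev_le {n : ℕ} {M : Mech n} (hIR : IR M) {H : ℝ} (hH : 0 ≤ H)
    {D : Fin n → Measure ℝ} [∀ i, IsProbabilityMeasure (D i)]
    (hD : ∀ i, D i (Icc 0 H) = 1) : Rev M (Measure.pi D) ≤ H := by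
  unfold Rev
  by_cases hi : Integrable (fun b => ∑ i, M.pay b i) (Measure.pi D)
  · have := integral_mono_ae hi (integrable_const H)
      ((ae_supp hD).mono fun b hb => sum_pay_le hIR hH hb)
    simpa using this
  · rw [integral_undef hi]; exact hH

lemma bdd_rev {n : ℕ} {H : ℝ} (hH : 0 ≤ H)
    {D : Fin n → Measure ℝ} [∀ i, IsProbabilityMeasure (D i)]
    (hD : ∀ i, D i (Icc 0 H) = 1) :
    BddAbove {r | ∃ M : Mech n, DSIC M ∧ IR M ∧ r = Rev M (Measure.pi D)} := by
  refine ⟨H, ?_⟩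
  rintro r ⟨M, -, hIR, rfl⟩
  exact rev_le hIR hH hD

/-- The null mechanism. -/
def nullMech (n : ℕ) : Mech n where
  alloc _ _ := 0
  pay _ _ := 0
  alloc_nonneg _ _ := le_rfl
  alloc_sum_le_one _ := by simp
  meas_alloc _ := measurable_const
  meas_pay _ := measurable_const

lemma null_mem {n : ℕ} (μ : Measure (Fin n → ℝ)) :
    (0:ℝ) ∈ {r | ∃ M : Mech n, DSIC M ∧ IR M ∧ r = Rev M μ} :=
  ⟨nullMech n, fun i v v' => by simp [util, nullMech], fun i v => by simp [util, nullMech],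
    by simp [Rev, nullMech]⟩

lemma rev_bound {n : ℕ} {H ε : ℝ} (hH : 0 ≤ H) (hε : 0 ≤ ε)
    {D Dhat : Fin n → Measure ℝ} [∀ i, IsProbabilityMeasure (D i)]
    [∀ i, IsProbabilityMeasure (Dhat i)]
    (hD : ∀ i, D i (Icc 0 H) = 1) (hDhat : ∀ i, Dhat i (Icc 0 H) = 1)
    (hL : ∀ i x, cdf (Dhat i) x ≤ cdf (D i) (x + ε) + ε)
    {M : Mech n} (hM : DSIC M) (hIR : IR M) :
    Rev M (Measure.pi D) ≤ OPT (Measure.pi Dhat) + (n * H + 1) * ε := by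
  have hbdd := bdd_rev hH hDhat
  have hopt0 : 0 ≤ OPT (Measure.pi Dhat) := le_csSup hbdd (null_mem _)
  by_cases hi : Integrable (fun b => ∑ i, M.pay b i) (Measure.pi D)
  swap
  · unfold Rev; rw [integral_undef hi]; positivity
  set g : (Fin n → ℝ) → ℝ := fun v => max 0 ((∑ i, M.pay v i) - ε) with hg
  have mg : Measurable g := measurable_const.max ((meas_sum_pay M).sub_const _)
  have g0 : ∀ v, 0 ≤ g v := fun v => le_max_left _ _
  have gH : ∀ v : Fin n → ℝ, (∀ i, v i ∈ Icc 0 H) → g v ≤ H := fun v hv =>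
    max_le hH (by linarith [sum_pay_le hIR hH hv])
  set Q : (Fin n → ℝ) → (Fin n → ℝ) := fun q i => qf (D i) (q i) with hQ
  have mQ : Measurable Q := measurable_pi_lambda _ fun i =>
    (qf_mono hH (hD i)).measurable.comp (measurable_pi_apply i)
  have QH : ∀ q i, Q q i ∈ Icc 0 H := fun q i => ⟨qf_nonneg _, qf_le_H hH (hD i) _⟩
  set h : (Fin n → ℝ) → ℝ := fun q => g (Q q) with hh
  have mh : Measurable h := mg.comp mQ
  have h0 : ∀ q, 0 ≤ h q := fun q => g0 _
  have hhH : ∀ q, h q ≤ H := fun q => gH _ (QH q)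
  -- step 1: revenue bounded via g
  have s1 : Rev M (Measure.pi D) - ε ≤ ∫ v, g v ∂(Measure.pi D) := by
    have ig : Integrable g (Measure.pi D) := by
      refine Integrable.of_bound mg.aestronglyMeasurable H ((ae_supp hD).mono fun v hv => ?_)
      rw [Real.norm_of_nonneg (g0 v)]
      exact gH v hv
    have := integral_mono (hi.sub (integrable_const ε)) ig (fun v => le_max_right _ _)
    simp only [Pi.sub_apply] at this
    rw [integral_sub hi (integrable_const ε)] at this
    simpa [Rev] using this
  have hmapQ : (Measure.pi fun _ : Fin n => unif).map Q = Measure.pi D := by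
    have hinst : ∀ i, SigmaFinite (unif.map (qf (D i))) := fun i => by
      rw [map_qf hH (hD i)]; infer_instance
    have := Measure.pi_map_pi (μ := fun _ : Fin n => unif) (f := fun i => qf (D i))
      (fun i => (qf_mono hH (hD i)).measurable.aemeasurable)
    rw [hQ, this]
    congr 1
    funext i
    exact map_qf hH (hD i)
  have s2 : ∫ v, g v ∂(Measure.pi D) = ∫ q, h q ∂(Measure.pi fun _ : Fin n => unif) := by
    rw [← hmapQ, integral_map mQ.aemeasurable mg.aestronglyMeasurable]
  have s3 := shift_bound mh hε h0 hhH
  -- step 4: transport to Dhat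
  set T : (Fin n → ℝ) × (Fin n → ℝ) → (Fin n → ℝ) := fun z i => dtr (Dhat i) (z.1 i) (z.2 i) with hT
  have mT : Measurable T := by
    refine measurable_pi_lambda _ fun i => ?_
    have hpair : Measurable fun z : (Fin n → ℝ) × (Fin n → ℝ) => (z.1 i, z.2 i) :=
      ((measurable_pi_apply i).comp measurable_fst).prodMk
        ((measurable_pi_apply i).comp measurable_snd)
    exact (meas_dtr (P := Dhat i)).comp hpair
  have hmapT : ((Measure.pi Dhat).prod (Measure.pi fun _ : Fin n => unif)).map T =
      Measure.pi fun _ : Fin n => unif := by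
    have hp := measurePreserving_arrowProdEquivProdArrow ℝ ℝ (Fin n) Dhat (fun _ => unif)
    have hinst : ∀ i, SigmaFinite (((Dhat i).prod unif).map fun z => dtr (Dhat i) z.1 z.2) :=
      fun i => by rw [map_dtr (hDhat i)]; infer_instance
    have := Measure.pi_map_pi (μ := fun i : Fin n => (Dhat i).prod unif)
      (f := fun i z => dtr (Dhat i) z.1 z.2) (fun i => meas_dtr.aemeasurable)
    rw [← hp.map_eq, Measure.map_map mT hp.measurable]
    refine Eq.trans (Eq.trans ?_ this) ?_
    · rfl
    · congr 1
      funext i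
      exact map_dtr (hDhat i)
  have msh : Measurable fun q : Fin n → ℝ => fun i => q i - ε :=
    measurable_pi_lambda _ fun i => (measurable_pi_apply i).sub_const _
  set G : (Fin n → ℝ) × (Fin n → ℝ) → ℝ := fun z => h (fun i => T z i - ε) with hG
  have mG : Measurable G := (mh.comp msh).comp mT
  have s4 : ∫ q, h (fun i => q i - ε) ∂(Measure.pi fun _ : Fin n => unif) =
      ∫ z, G z ∂((Measure.pi Dhat).prod (Measure.pi fun _ : Fin n => unif)) := by
    conv_lhs => rw [← hmapT]
    exact integral_map mT.aemeasurable (mh.comp msh).aestronglyMeasurable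
  have iG : Integrable G ((Measure.pi Dhat).prod (Measure.pi fun _ : Fin n => unif)) := by
    refine Integrable.of_bound mG.aestronglyMeasurable H (Filter.Eventually.of_forall fun v => ?_)
    rw [Real.norm_of_nonneg (h0 _)]
    exact hhH _
  have s5 : ∀ r : Fin n → ℝ, (∀ i, r i ∈ Ioc (0:ℝ) 1) →
      ∫ b, G (b, r) ∂(Measure.pi Dhat) ≤ OPT (Measure.pi Dhat) := by
    intro r hr
    obtain ⟨M', hM', hIR', hp0, hp⟩ := transform hM hIR (ε := ε)
      (w := fun i t => qf (D i) (dtr (Dhat i) t (r i) - ε))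
      (fun i s t hst => qf_mono hH (hD i) (sub_le_sub_right (dtr_mono (hr i) hst) ε)) hε
      (fun i t => qf_nonneg _)
      (fun i t ht => by
        rw [qf_le_iff hH (hD i) (by linarith)]
        refine (min_le_left _ _).trans ?_
        linarith [dtr_le (P := Dhat i) (hr i) t, hL i t])
    refine le_trans ?_ (le_csSup hbdd ⟨M', hM', hIR', rfl⟩)
    unfold Rev
    refine integral_mono_of_nonneg (Filter.Eventually.of_forall fun b => h0 _) ?_ ?_
    · refine Integrable.of_bound (meas_sum_pay M').aestronglyMeasurable H
        ((ae_supp hDhat).mono fun b hb => ?_)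
      rw [Real.norm_of_nonneg (hp0 b)]
      exact sum_pay_le hIR' hH hb
    · filter_upwards [ae_supp hDhat] with b hb
      exact max_le (hp0 b) (hp b fun i => (hb i).1)
  have s6 : ∫ z, G z ∂((Measure.pi Dhat).prod (Measure.pi fun _ : Fin n => unif)) ≤
      OPT (Measure.pi Dhat) := by
    rw [integral_prod_symm _ iG]
    have hae : ∀ᵐ r ∂(Measure.pi fun _ : Fin n => unif), ∀ i, r i ∈ Ioc (0:ℝ) 1 := by
      rw [ae_all_iff]
      intro i
      have : ∀ᵐ r ∂unif, r ∈ Ioc (0:ℝ) 1 := ae_restrict_mem measurableSet_Ioc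
      exact Measure.tendsto_eval_ae_ae.eventually this
    have := integral_mono_ae iG.integral_prod_right (integrable_const (OPT (Measure.pi Dhat)))
      (hae.mono fun r hr => s5 r hr)
    simpa using this
  nlinarith

lemma opt_bound {n : ℕ} {H ε : ℝ} (hH : 0 ≤ H) (hε : 0 ≤ ε)
    {D Dhat : Fin n → Measure ℝ} [∀ i, IsProbabilityMeasure (D i)]
    [∀ i, IsProbabilityMeasure (Dhat i)]
    (hD : ∀ i, D i (Icc 0 H) = 1) (hDhat : ∀ i, Dhat i (Icc 0 H) = 1)
    (hL : ∀ i x, cdf (Dhat i) x ≤ cdf (D i) (x + ε) + ε) :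
    OPT (Measure.pi D) ≤ OPT (Measure.pi Dhat) + (n * H + 1) * ε := by
  refine csSup_le ⟨0, null_mem _⟩ ?_
  rintro r ⟨M, hM, hIR, rfl⟩
  exact rev_bound hH hε hD hDhat hL hM hIR

end SingleItem

open SingleItem

/-- Lévy-continuity of the optimal revenue, single item: if each `D i` and
`D̂ i` is supported on `[0,H]` and they are within Lévy distance `ε`, then
`|OPT(D) − OPT(D̂)| ≤ (6nH + 3nε + 2)·ε`. -/
theorem stmt3 (n : ℕ) (H ε : ℝ) (hH : 0 < H) (hε : 0 < ε)
    (D Dhat : Fin n → Measure ℝ)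
    (hDprob : ∀ i, IsProbabilityMeasure (D i))
    (hDhatprob : ∀ i, IsProbabilityMeasure (Dhat i))
    (hDsupp : ∀ i, D i (Icc 0 H) = 1)
    (hDhatsupp : ∀ i, Dhat i (Icc 0 H) = 1)
    (hL : ∀ i, LevyLe (D i) (Dhat i) ε) :
    |OPT (Measure.pi D) - OPT (Measure.pi Dhat)| ≤ (6 * n * H + 3 * n * ε + 2) * ε := by
  have h1 : OPT (Measure.pi D) ≤ OPT (Measure.pi Dhat) + (n * H + 1) * ε := by
    refine opt_bound hH.le hε.le hDsupp hDhatsupp fun i x => ?_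
    have := (hL i x).2
    rwa [ProbabilityTheory.cdf_eq_real, ProbabilityTheory.cdf_eq_real]
  have h2 : OPT (Measure.pi Dhat) ≤ OPT (Measure.pi D) + (n * H + 1) * ε := by
    refine opt_bound hH.le hε.le hDhatsupp hDsupp fun i x => ?_
    have := (hL i (x + ε)).1
    rw [add_sub_cancel_right] at this
    rw [ProbabilityTheory.cdf_eq_real, ProbabilityTheory.cdf_eq_real]
    simp only [measureReal_def]
    linarith
  have h3 : (n * H + 1) * ε ≤ (6 * n * H + 3 * n * ε + 2) * ε := by
    refine mul_le_mul_of_nonneg_right ?_ hε.le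
    have : 0 ≤ (n:ℝ) * H := by positivity
    have : 0 ≤ (n:ℝ) * ε := by positivity
    nlinarith
  rw [abs_le]
  constructor <;> linarith
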